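/- Let G be the subgroup of Bir(ℙ²_ℚ) = Aut_ℚ(ℚ(x,y)) generated by the three automorphisms s, a, m determined by s(x) = x+1, s(y) = y; a(x) = x, a(y) = y+1; m(x) = x, m(y) = x·y. Then G is solvable of derived length exactly 3 (its third derived subgroup is trivial but its second derived subgroup is not), and G is not linear over any field: for every field K and every integer n ≥ 1 there is no injective group homomorphism from G into GL(n,K). -/

import Mathlib

set_option autoImplicit false

noncomputable section

universe u

/-- The field `ℚ(x,y)` of rational functions in two variables over `ℚ`. -/
abbrev KQ : Type := FractionRing (MvPolynomial (Fin 2) ℚ)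

/-- The plane Cremona group `Bir(ℙ²_ℚ) = Aut_ℚ(ℚ(x,y))`. -/
abbrev CremonaQ : Type := KQ ≃ₐ[ℚ] KQ

/-- The coordinate function `x`. -/
def xQ : KQ := algebraMap (MvPolynomial (Fin 2) ℚ) KQ (MvPolynomial.X 0)

/-- The coordinate function `y`. -/
def yQ : KQ := algebraMap (MvPolynomial (Fin 2) ℚ) KQ (MvPolynomial.X 1)

open scoped commutatorElement

section Linear

variable {K : Type*} [Field K]

section Commutative

variable {A : Type*} [CommRing A] [Algebra K A] [FiniteDimensional K A]

theorem isNilpotent_of_forall_algHom_eq_zero {b : A}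
    (h : ∀ ψ : A →ₐ[K] AlgebraicClosure K, ψ b = 0) : IsNilpotent b := by
  rw [nilpotent_iff_mem_prime]
  intro P hP
  have : Algebra.IsAlgebraic K (A ⧸ P) := inferInstance
  let ψ : (A ⧸ P) →ₐ[K] AlgebraicClosure K := IsAlgClosed.lift
  have hinj : Function.Injective ψ := by
    have := Algebra.IsIntegral.isField_iff_isField (algebraMap K (A ⧸ P)).injective
    let := (this.mp (Field.toIsField K)).toField
    exact ψ.toRingHom.injective
  rw [← Ideal.Quotient.eq_zero_iff_mem]
  apply hinj
  simpa using h (ψ.comp (Ideal.Quotient.mkₐ K P))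

theorem exists_isNilpotent_pow_sub_pow (c : A →ₐ[K] A) (b : A) :
    ∃ i j : ℕ, i < j ∧ IsNilpotent ((c ^ i) b - (c ^ j) b) := by
  obtain ⟨i, j, hij, h⟩ := Finite.exists_ne_map_eq_of_infinite
    (fun (k : ℕ) (ψ : A →ₐ[K] AlgebraicClosure K) => ψ.comp (c ^ k))
  have key : ∀ ψ : A →ₐ[K] AlgebraicClosure K, ψ ((c ^ i) b) = ψ ((c ^ j) b) :=
    fun ψ => DFunLike.congr_fun (congrFun h ψ) b
  rcases lt_or_gt_of_ne hij with hlt | hlt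
  · exact ⟨i, j, hlt, isNilpotent_of_forall_algHom_eq_zero (K := K)
      fun ψ => by rw [map_sub, key, sub_self]⟩
  · exact ⟨j, i, hlt, isNilpotent_of_forall_algHom_eq_zero (K := K)
      fun ψ => by rw [map_sub, key, sub_self]⟩

theorem isNilpotent_map_sub_self [CharZero K] (c : A →ₐ[K] A) {b : A}
    (h : IsNilpotent (c (c b - b) - (c b - b))) : IsNilpotent (c b - b) := by
  have hc : ∀ (k : ℕ) (ψ : A →ₐ[K] AlgebraicClosure K),
      ψ ((c ^ k) (c b - b)) = ψ (c b - b) := by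
    intro k ψ
    induction k with
    | zero => simp
    | succ k ih =>
      have h1 := ((h.map (c ^ k)).map ψ).eq_zero
      rw [map_sub, map_sub, sub_eq_zero, ih] at h1
      rw [pow_succ]
      exact h1
  have hb : ∀ (k : ℕ) (ψ : A →ₐ[K] AlgebraicClosure K),
      ψ ((c ^ k) b) = ψ b + k * ψ (c b - b) := by
    intro k ψ
    induction k with
    | zero => simp
    | succ k ih =>
      have h1 := hc k ψ
      rw [map_sub, map_sub, sub_eq_iff_eq_add, ih] at h1
      rw [pow_succ, AlgHom.mul_apply, h1]
      push_cast
      ring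
  obtain ⟨i, j, hij, hn⟩ := exists_isNilpotent_pow_sub_pow c b
  refine isNilpotent_of_forall_algHom_eq_zero (K := K) fun ψ => ?_
  have h1 := (hn.map ψ).eq_zero
  rw [map_sub, hb, hb] at h1
  have h2 : ((i : AlgebraicClosure K) - j) * ψ (c b - b) = 0 := by linear_combination h1
  have : CharZero (AlgebraicClosure K) := charZero_of_injective_algebraMap
    (algebraMap K (AlgebraicClosure K)).injective
  refine (mul_eq_zero.mp h2).resolve_left ?_
  exact sub_ne_zero.mpr (by exact_mod_cast hij.ne)

theorem isNilpotent_map_sub_of_isNilpotent_sub_one [CharZero K] (c : A →ₐ[K] A)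
    (hc : IsNilpotent (c.toLinearMap - 1)) (b : A) : IsNilpotent (c b - b) := by
  obtain ⟨N, hN⟩ := hc
  have key : ∀ (k : ℕ) (a : A),
      IsNilpotent (((c.toLinearMap - 1) ^ (k + 1)) a) → IsNilpotent (c a - a) := by
    intro k
    induction k with
    | zero => intro a h; simpa using h
    | succ k ih =>
      intro a h
      apply isNilpotent_map_sub_self
      apply ih
      rw [pow_succ] at h
      simpa using h
  apply key N b
  rw [pow_succ', hN]
  simp

/-- The commutator of an algebra endomorphism with a unit. -/
def twistedCommutator (c : A →ₐ[K] A) (w : Aˣ) : Aˣ := Units.map (c : A →* A) w * w⁻¹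

omit [FiniteDimensional K A] in
theorem twistedCommutator_iterate_sub_one_mem (c : A →ₐ[K] A) {J : Ideal A}
    (hJ : ∀ a ∈ J, c a ∈ J) {N : ℕ} (hN : (c.toLinearMap - 1) ^ N = 0) {i : ℕ} (hi : i ≠ 0)
    {w : Aˣ} (hw : (w : A) - 1 ∈ J ^ i) :
    (((twistedCommutator c)^[N] w : Aˣ) : A) - 1 ∈ J ^ (i + 1) := by
  have hpow : ∀ (k : ℕ), ∀ a ∈ J ^ k, c a ∈ J ^ k := by
    intro k a ha
    have h1 : Ideal.map c J ≤ J := Ideal.map_le_iff_le_comap.mpr hJ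
    have h2 := Ideal.mem_map_of_mem c ha
    rw [Ideal.map_pow] at h2
    exact Ideal.pow_right_mono h1 k h2
  have key : ∀ k : ℕ, (((twistedCommutator c)^[k] w : Aˣ) : A) - 1 ∈ J ^ i ∧
      (((twistedCommutator c)^[k] w : Aˣ) : A) - 1 -
        ((c.toLinearMap - 1) ^ k) ((w : A) - 1) ∈ J ^ (i + 1) := by
    intro k
    induction k with
    | zero => simpa using hw
    | succ k ih =>
      obtain ⟨h1, h2⟩ := ih
      rw [Function.iterate_succ_apply']
      set z := (twistedCommutator c)^[k] w
      set e := ((c.toLinearMap - 1) ^ k) ((w : A) - 1)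
      have hz : ((twistedCommutator c z : Aˣ) : A) = c z * ((z⁻¹ : Aˣ) : A) := rfl
      have hzz : (z : A) * ((z⁻¹ : Aˣ) : A) = 1 := z.mul_inv
      have hd : c z - z ∈ J ^ i := by
        have := sub_mem (hpow i _ h1) h1
        rwa [map_sub, map_one, sub_sub_sub_cancel_right] at this
      have hz' : ((z⁻¹ : Aˣ) : A) - 1 ∈ J := by
        have := Ideal.mul_mem_left _ (-((z⁻¹ : Aˣ) : A)) (Ideal.pow_le_self hi h1)
        convert this using 1
        linear_combination hzz
      have e1 : ((twistedCommutator c z : Aˣ) : A) - 1 =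
          (c z - z) + (c z - z) * (((z⁻¹ : Aˣ) : A) - 1) := by
        rw [hz]; linear_combination hzz
      have h3 : (c z - z) * (((z⁻¹ : Aˣ) : A) - 1) ∈ J ^ (i + 1) := by
        rw [pow_succ]; exact Ideal.mul_mem_mul hd hz'
      refine ⟨?_, ?_⟩
      · rw [e1]
        exact add_mem hd (Ideal.pow_le_pow_right (Nat.le_succ i) h3)
      · have h4 := add_mem (sub_mem (hpow _ _ h2) h2) h3
        rw [e1]
        have e2 : ((c.toLinearMap - 1) ^ (k + 1)) ((w : A) - 1) = c e - e := by
          rw [pow_succ']; rfl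
        rw [e2]
        have e3 : c z - z + (c z - z) * (((z⁻¹ : Aˣ) : A) - 1) - (c e - e) =
            c (z - 1 - e) - (z - 1 - e) + (c z - z) * (((z⁻¹ : Aˣ) : A) - 1) := by
          simp only [map_sub, map_one]
          ring
        rw [e3]
        exact h4
  have h := (key N).2
  rwa [hN, LinearMap.zero_apply, sub_zero] at h

theorem exists_twistedCommutator_iterate_eq_one [CharZero K] (c : A →ₐ[K] A)
    (hc : IsNilpotent (c.toLinearMap - 1)) (w : Aˣ) :
    ∃ k, (twistedCommutator c)^[k] w = 1 := by
  obtain ⟨N, hN⟩ := hc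
  have : IsNoetherianRing A := IsNoetherianRing.of_finite K A
  obtain ⟨M, hM⟩ := IsNoetherianRing.isNilpotent_nilradical A
  have hJ : ∀ a ∈ nilradical A, c a ∈ nilradical A := fun a ha =>
    mem_nilradical.mpr ((mem_nilradical.mp ha).map c)
  have key : ∀ i : ℕ, ∃ k,
      (((twistedCommutator c)^[k] w : Aˣ) : A) - 1 ∈ nilradical A ^ (i + 1) := by
    intro i
    induction i with
    | zero =>
      refine ⟨1, ?_⟩
      have h1 := mem_nilradical.mpr (isNilpotent_map_sub_of_isNilpotent_sub_one c ⟨N, hN⟩ w)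
      have h2 := Ideal.mul_mem_right ((w⁻¹ : Aˣ) : A) _ h1
      simpa [sub_mul, twistedCommutator] using h2
    | succ i ih =>
      obtain ⟨k, hk⟩ := ih
      refine ⟨N + k, ?_⟩
      rw [Function.iterate_add_apply]
      exact twistedCommutator_iterate_sub_one_mem c hJ hN (Nat.succ_ne_zero i) hk
  obtain ⟨k, hk⟩ := key M
  refine ⟨k, Units.ext ?_⟩
  rw [pow_succ, hM, zero_mul, Ideal.zero_eq_bot, Ideal.mem_bot, sub_eq_zero] at hk
  exact hk

end Commutative

section Representation

variable {R : Type*} [Ring R] [Algebra K R] {G : Type*} [Group G]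

/-- Conjugation by a unit, as an algebra endomorphism. -/
def conjAlgHom (U : Rˣ) : R →ₐ[K] R where
  toFun x := U * x * ((U⁻¹ : Rˣ) : R)
  map_one' := by simp
  map_mul' x y := by simp [mul_assoc]
  map_zero' := by simp
  map_add' x y := by simp [mul_add, add_mul]
  commutes' r := by
    rw [← Algebra.commutes, mul_assoc, U.mul_inv, mul_one]

theorem isNilpotent_conjAlgHom_sub_one {U : Rˣ} (hU : IsNilpotent ((U : R) - 1)) :
    IsNilpotent ((conjAlgHom (K := K) U).toLinearMap - 1) := by
  have hl : IsNilpotent (LinearMap.mulLeft K ((U : R) - 1)) := by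
    rwa [LinearMap.isNilpotent_mulLeft_iff]
  have hr : IsNilpotent (LinearMap.mulRight K ((U : R) - 1)) := by
    rwa [LinearMap.isNilpotent_mulRight_iff]
  have hd := (LinearMap.commute_mulLeft_right (R := K) ((U : R) - 1) (U - 1)).isNilpotent_sub hl hr
  have e : (conjAlgHom (K := K) U).toLinearMap - 1 =
      (LinearMap.mulLeft K ((U : R) - 1) - LinearMap.mulRight K ((U : R) - 1)) *
        LinearMap.mulRight K ((U⁻¹ : Rˣ) : R) := by
    ext x
    simp [conjAlgHom, sub_mul, mul_sub, mul_assoc]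
  rw [e]
  refine Commute.isNilpotent_mul_right ?_ hd
  apply Commute.sub_left
  · exact LinearMap.commute_mulLeft_right _ _
  · ext x
    simp [sub_mul, mul_sub, mul_assoc]

theorem exists_commRing_of_commutative_subgroup [FiniteDimensional K R] (φ : G →* Rˣ)
    {H : Subgroup G} (hH : ∀ a ∈ H, ∀ b ∈ H, a * b = b * a)
    {g : G} (hg : ∀ h ∈ H, g * h * g⁻¹ ∈ H) :
    ∃ B : Subalgebra K R, ∃ _ : IsMulCommutative B, ∃ c : B →ₐ[K] B,
      (∀ b : B, (c b : R) = conjAlgHom (K := K) (φ g) b) ∧ ∀ h ∈ H, ((φ h : Rˣ) : R) ∈ B := by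
  set S : Set R := {r | ∃ h ∈ H, ((φ h : Rˣ) : R) = r}
  have hS : ∀ x ∈ S, ∀ y ∈ S, x * y = y * x := by
    rintro _ ⟨a, ha, rfl⟩ _ ⟨b, hb, rfl⟩
    rw [← Units.val_mul, ← Units.val_mul, ← map_mul, ← map_mul, hH a ha b hb]
  have hle : (Algebra.adjoin K S).map (conjAlgHom (φ g)) ≤ Algebra.adjoin K S := by
    rw [AlgHom.map_adjoin]
    apply Algebra.adjoin_mono
    rintro _ ⟨_, ⟨h, hh, rfl⟩, rfl⟩
    exact ⟨g * h * g⁻¹, hg h hh, by simp [conjAlgHom]⟩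
  refine ⟨Algebra.adjoin K S, Algebra.isMulCommutative_adjoin K hS,
    ((conjAlgHom (φ g)).comp (Algebra.adjoin K S).val).codRestrict _
      fun b => hle ⟨b, b.2, rfl⟩, fun b => rfl, fun h hh => Algebra.subset_adjoin ⟨h, hh, rfl⟩⟩

open scoped IsMulCommutative in
theorem exists_isNilpotent_map_commutator_sub_one [FiniteDimensional K R] (φ : G →* Rˣ)
    {T : Subgroup G} (hT : ∀ a ∈ T, ∀ b ∈ T, a * b = b * a)
    {s t : G} (ht : t ∈ T) (hs : ∀ h ∈ T, s * h * s⁻¹ ∈ T) :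
    ∃ N : ℕ, N ≠ 0 ∧ IsNilpotent (((φ ⁅s ^ N, t⁆ : Rˣ) : R) - 1) := by
  obtain ⟨B, _, c, hc, hB⟩ := exists_commRing_of_commutative_subgroup (K := K) φ hT hs
  have hpow : ∀ k : ℕ, ((c ^ k) ⟨_, hB t ht⟩ : R) = φ (s ^ k * t * (s ^ k)⁻¹) := by
    intro k
    induction k with
    | zero => simp
    | succ k ih =>
      rw [pow_succ', AlgHom.mul_apply, hc, ih, pow_succ']
      simp [conjAlgHom, mul_assoc]
  obtain ⟨i, j, hij, hn⟩ := exists_isNilpotent_pow_sub_pow c (⟨_, hB t ht⟩ : B)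
  refine ⟨j - i, Nat.sub_ne_zero_of_lt hij, ?_⟩
  have h1 : IsNilpotent (((φ (s ^ i * t * (s ^ i)⁻¹) : Rˣ) : R) -
      ((φ (s ^ j * t * (s ^ j)⁻¹) : Rˣ) : R)) := by
    rw [← hpow, ← hpow]
    exact hn.map B.val
  have h2 := h1.map (conjAlgHom (K := K) (φ (s ^ i)⁻¹))
  have e : (conjAlgHom (K := K) (φ (s ^ i)⁻¹)) (((φ (s ^ i * t * (s ^ i)⁻¹) : Rˣ) : R) -
      ((φ (s ^ j * t * (s ^ j)⁻¹) : Rˣ) : R)) =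
      -((((φ ⁅s ^ (j - i), t⁆ : Rˣ) : R) - 1) * ((φ t : Rˣ) : R)) := by
    have e1 : ∀ g : G, (conjAlgHom (K := K) (φ (s ^ i)⁻¹)) ((φ g : Rˣ) : R) =
        ((φ ((s ^ i)⁻¹ * g * s ^ i) : Rˣ) : R) := fun g => by simp [conjAlgHom]
    obtain ⟨k, rfl⟩ := Nat.exists_eq_add_of_lt hij
    have e2 : (s ^ i)⁻¹ * (s ^ i * t * (s ^ i)⁻¹) * s ^ i = t := by group
    have e3 : (s ^ i)⁻¹ * (s ^ (i + k + 1) * t * (s ^ (i + k + 1))⁻¹) * s ^ i =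
        ⁅s ^ (i + k + 1 - i), t⁆ * t := by
      rw [show i + k + 1 - i = k + 1 by omega, show i + k + 1 = i + (k + 1) by omega, pow_add,
        commutatorElement_def]
      group
    rw [map_sub, e1, e1, e2, e3, map_mul, Units.val_mul]
    noncomm_ring
  rw [e, isNilpotent_neg_iff] at h2
  have hcomm : Commute (((φ ⁅s ^ (j - i), t⁆ : Rˣ) : R) - 1) ((φ t : Rˣ) : R) := by
    apply Commute.sub_left _ (Commute.one_left _)
    have hmem : ∀ k : ℕ, s ^ k * t * (s ^ k)⁻¹ ∈ T := by
      intro k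
      induction k with
      | zero => simpa using ht
      | succ k ih => simpa [pow_succ', mul_assoc] using hs _ ih
    have := hT _ (T.mul_mem (hmem (j - i)) (T.inv_mem ht)) t ht
    rw [← commutatorElement_def] at this
    rw [commute_iff_eq, ← Units.val_mul, ← Units.val_mul, ← map_mul, ← map_mul, this]
  have h3 := Commute.isNilpotent_mul_right (y := ((φ t⁻¹ : Rˣ) : R)) ?_ h2
  · simpa [mul_assoc] using h3
  · have h4 : Commute (((φ t : Rˣ) : R)) ((φ t⁻¹ : Rˣ) : R) := by simp [commute_iff_eq]
    have h5 : Commute (((φ ⁅s ^ (j - i), t⁆ : Rˣ) : R) - 1) ((φ t⁻¹ : Rˣ) : R) := by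
      rw [map_inv]
      exact hcomm.units_inv_right
    exact h5.mul_left h4

open scoped IsMulCommutative in
theorem exists_map_commutator_iterate_eq_one [CharZero K] [FiniteDimensional K R] (φ : G →* Rˣ)
    {V : Subgroup G} (hV : ∀ a ∈ V, ∀ b ∈ V, a * b = b * a)
    {u v : G} (hv : v ∈ V) (hu : ∀ h ∈ V, u * h * u⁻¹ ∈ V)
    (hφ : IsNilpotent (((φ u : Rˣ) : R) - 1)) :
    ∃ k : ℕ, φ ((fun w => ⁅u, w⁆)^[k] v) = 1 := by
  obtain ⟨B, _, c, hc, hB⟩ := exists_commRing_of_commutative_subgroup (K := K) φ hV hu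
  have hcn : IsNilpotent (c.toLinearMap - 1) := by
    obtain ⟨N, hN⟩ := isNilpotent_conjAlgHom_sub_one (K := K) hφ
    refine ⟨N, LinearMap.ext fun b => Subtype.ext ?_⟩
    have key : ∀ k : ℕ, ((((c.toLinearMap - 1) ^ k) b : B) : R) =
        (((conjAlgHom (K := K) (φ u)).toLinearMap - 1) ^ k) (b : R) := by
      intro k
      induction k with
      | zero => simp
      | succ k ih =>
        rw [pow_succ', pow_succ', Module.End.mul_apply, Module.End.mul_apply, ← ih]
        simp [hc]
    rw [key, hN]
    simp
  have hinv : ((φ v⁻¹ : Rˣ) : R) ∈ B := hB _ (V.inv_mem hv)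
  let w : Bˣ := ⟨⟨_, hB v hv⟩, ⟨_, hinv⟩, Subtype.ext (by simp), Subtype.ext (by simp)⟩
  obtain ⟨k, hk⟩ := exists_twistedCommutator_iterate_eq_one c hcn w
  have key : ∀ k : ℕ, Units.map (B.val : B →* R) ((twistedCommutator c)^[k] w) =
      φ ((fun w => ⁅u, w⁆)^[k] v) := by
    intro k
    induction k with
    | zero => exact Units.ext rfl
    | succ k ih =>
      rw [Function.iterate_succ_apply', Function.iterate_succ_apply', map_commutatorElement, ← ih]
      generalize (twistedCommutator c)^[k] w = z
      rw [twistedCommutator, map_mul, map_inv, commutatorElement_def]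
      congr 1
      exact Units.ext (hc z)
  refine ⟨k, ?_⟩
  rw [← key, hk, map_one]

theorem exists_map_pow_eq_one_of_isNilpotent {p : ℕ} (hp : p.Prime) [CharP K p] (U : Rˣ)
    (hU : IsNilpotent ((U : R) - 1)) : ∃ k : ℕ, k ≠ 0 ∧ U ^ k = 1 := by
  rcases subsingleton_or_nontrivial R with h | h
  · exact ⟨1, one_ne_zero, Subsingleton.elim _ _⟩
  have : Fact p.Prime := ⟨hp⟩
  have : CharP R p := charP_of_injective_algebraMap (algebraMap K R).injective p
  obtain ⟨N, hN⟩ := hU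
  refine ⟨p ^ N, pow_ne_zero _ hp.ne_zero, Units.ext ?_⟩
  have h1 := sub_pow_char_pow_of_commute (p := p) (n := N) (Commute.one_right (U : R))
  rw [pow_eq_zero_of_le (Nat.lt_pow_self hp.one_lt).le hN, one_pow, eq_comm, sub_eq_zero] at h1
  simpa using h1

theorem not_injective_of_commutator [FiniteDimensional K R]
    {T V : Subgroup G} (hT : ∀ a ∈ T, ∀ b ∈ T, a * b = b * a)
    (hV : ∀ a ∈ V, ∀ b ∈ V, a * b = b * a)
    {s t v : G} (ht : t ∈ T) (hv : v ∈ V) (hs : ∀ h ∈ T, s * h * s⁻¹ ∈ T)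
    (hTV : ∀ N : ℕ, ∀ h ∈ V, ⁅s ^ N, t⁆ * h * ⁅s ^ N, t⁆⁻¹ ∈ V)
    (hord : ∀ N k : ℕ, N ≠ 0 → k ≠ 0 → ⁅s ^ N, t⁆ ^ k ≠ 1)
    (hiter : ∀ N k : ℕ, N ≠ 0 → (fun w => ⁅⁅s ^ N, t⁆, w⁆)^[k] v ≠ 1)
    (φ : G →* Rˣ) : ¬ Function.Injective φ := by
  intro hφ
  obtain ⟨N, hN, hn⟩ := exists_isNilpotent_map_commutator_sub_one (K := K) φ hT ht hs
  obtain ⟨p, hp⟩ := CharP.exists K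
  rcases CharP.char_is_prime_or_zero K p with hp' | rfl
  · obtain ⟨k, hk, h⟩ := exists_map_pow_eq_one_of_isNilpotent (K := K) hp' _ hn
    rw [← map_pow] at h
    exact hord N k hN hk (hφ (h.trans (map_one φ).symm))
  · have : CharZero K := CharP.charP_to_charZero K
    obtain ⟨k, h⟩ := exists_map_commutator_iterate_eq_one (K := K) φ hV hv (hTV N) hn
    exact hiter N k hN (hφ (h.trans (map_one φ).symm))

end Representation

end Linear

section Cremona

/-- The subfield `ℚ(x)` of `ℚ(x,y)`. -/
def fieldX : IntermediateField ℚ KQ := IntermediateField.adjoin ℚ {xQ}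

theorem xQ_mem_fieldX : xQ ∈ fieldX :=
  IntermediateField.subset_adjoin ℚ _ rfl

theorem map_mem_fieldX {g : CremonaQ} (hg : g xQ ∈ fieldX) {B : KQ} (hB : B ∈ fieldX) :
    g B ∈ fieldX := by
  have : fieldX ≤ fieldX.comap (g : KQ →ₐ[ℚ] KQ) := by
    refine IntermediateField.adjoin_le_iff.mpr ?_
    rintro _ rfl
    exact hg
  exact this hB

theorem map_eq_self_of_mem_fieldX {g : CremonaQ} (hg : g xQ = xQ) {B : KQ} (hB : B ∈ fieldX) :
    g B = B := by
  induction hB using IntermediateField.adjoin_induction with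
  | mem z hz => rw [Set.mem_singleton_iff.mp hz, hg]
  | algebraMap r => exact g.commutes r
  | add a b _ _ ha hb => rw [map_add, ha, hb]
  | inv a _ ha => rw [map_inv₀, ha]
  | mul a b _ _ ha hb => rw [map_mul, ha, hb]

theorem cremona_inv_apply_apply (g : CremonaQ) (z : KQ) : g⁻¹ (g z) = z :=
  g.symm_apply_apply z

theorem cremona_inv_apply_eq {g : CremonaQ} {z w : KQ} (h : g w = z) : g⁻¹ z = w := by
  rw [← h, cremona_inv_apply_apply]

theorem cremona_ext {g h : CremonaQ} (hx : g xQ = h xQ) (hy : g yQ = h yQ) : g = h := by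
  have : (g : KQ →ₐ[ℚ] KQ).comp (IsScalarTower.toAlgHom ℚ (MvPolynomial (Fin 2) ℚ) KQ) =
      (h : KQ →ₐ[ℚ] KQ).comp (IsScalarTower.toAlgHom ℚ (MvPolynomial (Fin 2) ℚ) KQ) := by
    apply MvPolynomial.algHom_ext
    intro i
    fin_cases i
    · exact hx
    · exact hy
  have h2 : (g : KQ →+* KQ) = (h : KQ →+* KQ) := by
    apply IsFractionRing.injective_comp_algebraMap (A := MvPolynomial (Fin 2) ℚ)
    exact RingHom.ext fun p => DFunLike.congr_fun this p
  exact AlgEquiv.ext fun z => DFunLike.congr_fun h2 z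

theorem xQ_add_ratCast_ne_zero (k : ℚ) : xQ + (k : KQ) ≠ 0 := by
  intro h
  have h1 : algebraMap (MvPolynomial (Fin 2) ℚ) KQ (MvPolynomial.X 0 + MvPolynomial.C k) =
      algebraMap (MvPolynomial (Fin 2) ℚ) KQ 0 := by
    rw [map_add, map_zero, ← MvPolynomial.algebraMap_eq, ← IsScalarTower.algebraMap_apply]
    simpa [xQ] using h
  have h2 := congrArg (MvPolynomial.eval fun _ => 1 - k) (IsFractionRing.injective _ KQ h1)
  simp at h2

theorem xQ_ne_zero : xQ ≠ 0 := by
  simpa using xQ_add_ratCast_ne_zero 0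

theorem yQ_ne_zero : yQ ≠ 0 :=
  (map_ne_zero_iff _ (IsFractionRing.injective _ KQ)).mpr (MvPolynomial.X_ne_zero 1)

theorem xQ_add_natCast_ne_zero (N : ℕ) : xQ + (N : KQ) ≠ 0 := by
  simpa using xQ_add_ratCast_ne_zero N

theorem xQ_ne_one : xQ ≠ 1 := by
  intro h
  apply xQ_add_ratCast_ne_zero (-1)
  simp [h]

theorem xQ_add_natCast_pow_ne {N k : ℕ} (hN : N ≠ 0) (hk : k ≠ 0) :
    (xQ + (N : KQ)) ^ k ≠ xQ ^ k := by
  intro h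
  have h1 : algebraMap (MvPolynomial (Fin 2) ℚ) KQ ((MvPolynomial.X 0 + (N : MvPolynomial _ ℚ)) ^ k)
      = algebraMap (MvPolynomial (Fin 2) ℚ) KQ (MvPolynomial.X 0 ^ k) := by
    simpa [xQ] using h
  have h2 := congrArg (MvPolynomial.eval fun _ => (0 : ℚ)) (IsFractionRing.injective _ KQ h1)
  simp [hN, hk] at h2

/-- The automorphisms `(x, y) ↦ (x + k, A(x) y + B(x))`. -/
def affineTranslationGroup : Subgroup CremonaQ where
  carrier := {g | (∃ k : ℚ, g xQ = xQ + (k : KQ)) ∧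
    ∃ A ∈ fieldX, ∃ B ∈ fieldX, A ≠ 0 ∧ g yQ = A * yQ + B}
  one_mem' := ⟨⟨0, by simp⟩, 1, one_mem _, 0, zero_mem _, one_ne_zero, by simp⟩
  mul_mem' := by
    rintro g h ⟨⟨k, hk⟩, A, hA, B, hB, hA0, hg⟩ ⟨⟨l, hl⟩, C, hC, D, hD, hC0, hh⟩
    have hgL : g xQ ∈ fieldX := by
      rw [hk]; exact add_mem xQ_mem_fieldX (SubfieldClass.ratCast_mem _ k)
    refine ⟨⟨k + l, ?_⟩, g C * A, mul_mem (map_mem_fieldX hgL hC) hA, g C * B + g D,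
      add_mem (mul_mem (map_mem_fieldX hgL hC) hB) (map_mem_fieldX hgL hD),
      mul_ne_zero (by simpa using hC0) hA0, ?_⟩
    · simp [hk, hl]; ring
    · simp [hg, hh]; ring
  inv_mem' := by
    rintro g ⟨⟨k, hk⟩, A, hA, B, hB, hA0, hg⟩
    have hx : g⁻¹ xQ = xQ + ((-k : ℚ) : KQ) := cremona_inv_apply_eq (by simp [hk])
    have hgL : g⁻¹ xQ ∈ fieldX := by
      rw [hx]; exact add_mem xQ_mem_fieldX (SubfieldClass.ratCast_mem _ _)
    have hA' : g⁻¹ A ≠ 0 := by simpa using hA0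
    refine ⟨⟨-k, hx⟩, (g⁻¹ A)⁻¹, inv_mem (map_mem_fieldX hgL hA), -(g⁻¹ B / g⁻¹ A),
      neg_mem (div_mem (map_mem_fieldX hgL hB) (map_mem_fieldX hgL hA)), inv_ne_zero hA', ?_⟩
    have h1 := congrArg (g⁻¹ : CremonaQ) hg
    rw [cremona_inv_apply_apply, map_add, map_mul] at h1
    field_simp
    linear_combination -h1

/-- The automorphisms `(x, y) ↦ (x, A(x) y + B(x))`. -/
def affineGroup : Subgroup CremonaQ where
  carrier := {g | g xQ = xQ ∧ ∃ A ∈ fieldX, ∃ B ∈ fieldX, A ≠ 0 ∧ g yQ = A * yQ + B}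
  one_mem' := ⟨rfl, 1, one_mem _, 0, zero_mem _, one_ne_zero, by simp⟩
  mul_mem' := by
    rintro g h ⟨hk, A, hA, B, hB, hA0, hg⟩ ⟨hl, C, hC, D, hD, hC0, hh⟩
    refine ⟨by simp [hk, hl], C * A, mul_mem hC hA, C * B + D,
      add_mem (mul_mem hC hB) hD, mul_ne_zero hC0 hA0, ?_⟩
    simp [hg, hh, map_eq_self_of_mem_fieldX hk hC, map_eq_self_of_mem_fieldX hk hD]
    ring
  inv_mem' := by
    rintro g ⟨hk, A, hA, B, hB, hA0, hg⟩
    refine ⟨cremona_inv_apply_eq hk, A⁻¹, inv_mem hA, -(B / A), neg_mem (div_mem hB hA),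
      inv_ne_zero hA0, cremona_inv_apply_eq ?_⟩
    simp only [map_add, map_mul, map_neg, map_div₀, map_inv₀, hg, map_eq_self_of_mem_fieldX hk hA,
      map_eq_self_of_mem_fieldX hk hB]
    field_simp
    ring

/-- The automorphisms `(x, y) ↦ (x, y + B(x))`. -/
def translationGroup : Subgroup CremonaQ where
  carrier := {g | g xQ = xQ ∧ ∃ B ∈ fieldX, g yQ = yQ + B}
  one_mem' := ⟨rfl, 0, zero_mem _, by simp⟩
  mul_mem' := by
    rintro g h ⟨hk, B, hB, hg⟩ ⟨hl, D, hD, hh⟩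
    refine ⟨by simp [hk, hl], B + D, add_mem hB hD, ?_⟩
    simp [hg, hh, map_eq_self_of_mem_fieldX hk hD, add_assoc]
  inv_mem' := by
    rintro g ⟨hk, B, hB, hg⟩
    refine ⟨cremona_inv_apply_eq hk, -B, neg_mem hB, cremona_inv_apply_eq ?_⟩
    simp [hg, map_eq_self_of_mem_fieldX hk hB]

/-- The automorphisms `(x, y) ↦ (x, A(x) y)`. -/
def scalingGroup : Subgroup CremonaQ where
  carrier := {g | g xQ = xQ ∧ ∃ A ∈ fieldX, A ≠ 0 ∧ g yQ = A * yQ}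
  one_mem' := ⟨rfl, 1, one_mem _, one_ne_zero, by simp⟩
  mul_mem' := by
    rintro g h ⟨hk, A, hA, hA0, hg⟩ ⟨hl, C, hC, hC0, hh⟩
    refine ⟨by simp [hk, hl], C * A, mul_mem hC hA, mul_ne_zero hC0 hA0, ?_⟩
    simp [hg, hh, map_eq_self_of_mem_fieldX hk hC, mul_assoc]
  inv_mem' := by
    rintro g ⟨hk, A, hA, hA0, hg⟩
    refine ⟨cremona_inv_apply_eq hk, A⁻¹, inv_mem hA, inv_ne_zero hA0, cremona_inv_apply_eq ?_⟩
    simp [hg, map_eq_self_of_mem_fieldX hk hA, hA0]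

theorem commutator_affineTranslationGroup_le :
    ⁅affineTranslationGroup, affineTranslationGroup⁆ ≤ affineGroup := by
  rw [Subgroup.commutator_le]
  intro g hg h hh
  have hc := affineTranslationGroup.commutator_le_self
    (Subgroup.commutator_mem_commutator hg hh)
  refine ⟨?_, hc.2⟩
  obtain ⟨⟨k, hk⟩, -⟩ := hg
  obtain ⟨⟨l, hl⟩, -⟩ := hh
  have hk' : g⁻¹ xQ = xQ - (k : KQ) := cremona_inv_apply_eq (by simp [hk])
  have hl' : h⁻¹ xQ = xQ - (l : KQ) := cremona_inv_apply_eq (by simp [hl])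
  simp only [commutatorElement_def, AlgEquiv.mul_apply, hk', hl', map_sub, map_ratCast, hl,
    map_add, hk]
  ring

theorem commutator_affineGroup_le : ⁅affineGroup, affineGroup⁆ ≤ translationGroup := by
  rw [Subgroup.commutator_le]
  intro g hg h hh
  have hc := affineGroup.commutator_le_self (Subgroup.commutator_mem_commutator hg hh)
  obtain ⟨hk, A, hA, B, hB, hA0, hg⟩ := hg
  obtain ⟨hl, C, hC, D, hD, hC0, hh⟩ := hh
  refine ⟨hc.1, (C * B + D - B - A * D) / (A * C), ?_, ?_⟩
  · exact div_mem (sub_mem (sub_mem (add_mem (mul_mem hC hB) hD) hB) (mul_mem hA hD))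
      (mul_mem hA hC)
  have gA := map_eq_self_of_mem_fieldX hk hA
  have gB := map_eq_self_of_mem_fieldX hk hB
  have gC := map_eq_self_of_mem_fieldX hk hC
  have gD := map_eq_self_of_mem_fieldX hk hD
  have hA' := map_eq_self_of_mem_fieldX hl hA
  have hB' := map_eq_self_of_mem_fieldX hl hB
  have hC' := map_eq_self_of_mem_fieldX hl hC
  have hD' := map_eq_self_of_mem_fieldX hl hD
  have hg' : g⁻¹ yQ = (yQ - B) / A := cremona_inv_apply_eq (by simp [hg, gA, gB, hA0])
  have hh' : h⁻¹ yQ = (yQ - D) / C := cremona_inv_apply_eq (by simp [hh, hC', hD', hC0])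
  simp only [commutatorElement_def, AlgEquiv.mul_apply, hh', map_div₀, map_sub, hg',
    cremona_inv_apply_eq gC, cremona_inv_apply_eq gD, hh, hA', hB', hC', hD', map_add, map_mul,
    hg, gA, gB, gC, gD]
  field_simp
  ring

theorem translationGroup_comm {g h : CremonaQ} (hg : g ∈ translationGroup)
    (hh : h ∈ translationGroup) : g * h = h * g := by
  obtain ⟨hk, B, hB, hg⟩ := hg
  obtain ⟨hl, D, hD, hh⟩ := hh
  refine cremona_ext (by simp [hk, hl]) ?_
  simp [hg, hh, map_eq_self_of_mem_fieldX hk hD, map_eq_self_of_mem_fieldX hl hB]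
  ring

theorem scalingGroup_comm {g h : CremonaQ} (hg : g ∈ scalingGroup)
    (hh : h ∈ scalingGroup) : g * h = h * g := by
  obtain ⟨hk, A, hA, -, hg⟩ := hg
  obtain ⟨hl, C, hC, -, hh⟩ := hh
  refine cremona_ext (by simp [hk, hl]) ?_
  simp [hg, hh, map_eq_self_of_mem_fieldX hk hC, map_eq_self_of_mem_fieldX hl hA]
  ring

theorem conj_mem_scalingGroup {g h : CremonaQ} (hgx : g xQ = xQ + 1) (hgy : g yQ = yQ)
    (hh : h ∈ scalingGroup) : g * h * g⁻¹ ∈ scalingGroup := by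
  obtain ⟨hl, A, hA, hA0, hh⟩ := hh
  have hgL : g xQ ∈ fieldX := by rw [hgx]; exact add_mem xQ_mem_fieldX (one_mem _)
  refine ⟨?_, g A, map_mem_fieldX hgL hA, by simpa using hA0, ?_⟩
  · have hx : g⁻¹ xQ = xQ - 1 := cremona_inv_apply_eq (by simp [hgx])
    simp [hx, hl, hgx]
  · simp only [AlgEquiv.mul_apply, cremona_inv_apply_eq hgy, hh, map_mul, hgy]

theorem conj_mem_translationGroup {g h : CremonaQ} (hg : g ∈ scalingGroup)
    (hh : h ∈ translationGroup) : g * h * g⁻¹ ∈ translationGroup := by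
  obtain ⟨hk, A, hA, hA0, hg⟩ := hg
  obtain ⟨hl, B, hB, hh⟩ := hh
  have gA := map_eq_self_of_mem_fieldX hk hA
  have hg' : g⁻¹ yQ = yQ / A := cremona_inv_apply_eq (by simp [hg, gA, hA0])
  refine ⟨by simp [cremona_inv_apply_eq hk, hk, hl], B / A, div_mem hB hA, ?_⟩
  simp only [AlgEquiv.mul_apply, hg', map_div₀, hh, map_eq_self_of_mem_fieldX hl hA, map_add, hg,
    gA, map_eq_self_of_mem_fieldX hk hB]
  field_simp

theorem commutator_scaling_translation_apply {g h : CremonaQ} {A B : KQ} (hgx : g xQ = xQ)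
    (hA : A ∈ fieldX) (hA0 : A ≠ 0) (hgy : g yQ = A * yQ) (hhx : h xQ = xQ) (hB : B ∈ fieldX)
    (hhy : h yQ = yQ + B) :
    ⁅g, h⁆ xQ = xQ ∧ ⁅g, h⁆ yQ = yQ + (A⁻¹ - 1) * B := by
  have gA := map_eq_self_of_mem_fieldX hgx hA
  have gB := map_eq_self_of_mem_fieldX hgx hB
  have hB' := map_eq_self_of_mem_fieldX hhx hB
  have hg' : g⁻¹ yQ = yQ / A := cremona_inv_apply_eq (by simp [hgy, gA, hA0])
  have hh' : h⁻¹ yQ = yQ - B := cremona_inv_apply_eq (by simp [hhy, hB'])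
  constructor
  · simp [commutatorElement_def, cremona_inv_apply_eq hgx, cremona_inv_apply_eq hhx, hgx, hhx]
  · simp only [commutatorElement_def, AlgEquiv.mul_apply, hh', map_sub, hg', map_div₀,
      cremona_inv_apply_eq gB, hhy, map_eq_self_of_mem_fieldX hhx hA, hB', map_add, hgy, gA, gB]
    field_simp
    ring

theorem pow_shift_apply {s : CremonaQ} (hsx : s xQ = xQ + 1) (hsy : s yQ = yQ) (N : ℕ) :
    (s ^ N) xQ = xQ + N ∧ (s ^ N) yQ = yQ := by
  induction N with
  | zero => simp
  | succ N ih =>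
    rw [pow_succ, AlgEquiv.mul_apply, AlgEquiv.mul_apply, hsx, hsy, map_add, ih.1, ih.2, map_one]
    refine ⟨?_, rfl⟩
    push_cast
    ring

theorem commutator_pow_shift_apply {s m : CremonaQ} (hsx : s xQ = xQ + 1) (hsy : s yQ = yQ)
    (hmx : m xQ = xQ) (hmy : m yQ = xQ * yQ) (N : ℕ) :
    ⁅s ^ N, m⁆ xQ = xQ ∧ ⁅s ^ N, m⁆ yQ = (xQ + N) / xQ * yQ := by
  obtain ⟨hx, hy⟩ := pow_shift_apply hsx hsy N
  have hx' : (s ^ N)⁻¹ xQ = xQ - N :=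
    cremona_inv_apply_eq (by rw [map_sub, hx, map_natCast, add_sub_cancel_right])
  have hm' : m⁻¹ yQ = yQ / xQ := cremona_inv_apply_eq (by simp [hmx, hmy, xQ_ne_zero])
  constructor
  · simp only [commutatorElement_def, AlgEquiv.mul_apply, hx', cremona_inv_apply_eq hmx, hmx, hx,
      map_sub, map_natCast, add_sub_cancel_right]
  · simp only [commutatorElement_def, AlgEquiv.mul_apply, hm', map_div₀, hx',
      cremona_inv_apply_eq hy, hmx, hmy, map_sub, map_natCast, map_mul, hx, hy]
    rw [add_sub_cancel_right]
    field_simp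

end Cremona

theorem map_derivedSeries_succ_le {G : Type*} [Group G] {P : Subgroup G} {H H' : Subgroup G}
    {n : ℕ} (h : (derivedSeries P n).map P.subtype ≤ H) (hH : ⁅H, H⁆ ≤ H') :
    (derivedSeries P (n + 1)).map P.subtype ≤ H' := by
  rw [derivedSeries_succ, Subgroup.map_commutator]
  exact (Subgroup.commutator_mono h h).trans hH

/-- **Cornulier's example.** The subgroup `G` of `Bir(ℙ²_ℚ)` generated by the automorphisms
`s : (x,y) ↦ (x+1, y)`, `a : (x,y) ↦ (x, y+1)` and `m : (x,y) ↦ (x, x·y)` is solvable of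
derived length exactly `3`, and is not linear over any field: there is no injective group
homomorphism `G → GL(n,K)` for any field `K` and any `n ≥ 1`. -/
theorem cornulier_solvable_nonlinear (s a m : CremonaQ)
    (hsx : s xQ = xQ + 1) (hsy : s yQ = yQ)
    (hax : a xQ = xQ) (hay : a yQ = yQ + 1)
    (hmx : m xQ = xQ) (hmy : m yQ = xQ * yQ) :
    derivedSeries ↥(Subgroup.closure {s, a, m} : Subgroup CremonaQ) 3 = ⊥ ∧
    derivedSeries ↥(Subgroup.closure {s, a, m} : Subgroup CremonaQ) 2 ≠ ⊥ ∧
    ∀ (K : Type u) [Field K] (n : ℕ), 1 ≤ n →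
      ∀ φ : ↥(Subgroup.closure {s, a, m} : Subgroup CremonaQ) →*
            Matrix.GeneralLinearGroup (Fin n) K,
        ¬ Function.Injective φ := by
  have hs : s ∈ Subgroup.closure {s, a, m} := Subgroup.subset_closure (by simp)
  have ha : a ∈ Subgroup.closure {s, a, m} := Subgroup.subset_closure (by simp)
  have hm : m ∈ Subgroup.closure {s, a, m} := Subgroup.subset_closure (by simp)
  have hle : Subgroup.closure {s, a, m} ≤ affineTranslationGroup := by
    rw [Subgroup.closure_le]
    rintro g (rfl | rfl | rfl)
    · exact ⟨⟨1, by simp [hsx]⟩, 1, one_mem _, 0, zero_mem _, one_ne_zero, by simp [hsy]⟩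
    · exact ⟨⟨0, by simp [hax]⟩, 1, one_mem _, 1, one_mem _, one_ne_zero, by simp [hay]⟩
    · exact ⟨⟨0, by simp [hmx]⟩, xQ, xQ_mem_fieldX, 0, zero_mem _, xQ_ne_zero, by simp [hmy]⟩
  have hmT : m ∈ scalingGroup := ⟨hmx, xQ, xQ_mem_fieldX, xQ_ne_zero, hmy⟩
  have haV : a ∈ translationGroup := ⟨hax, 1, one_mem _, hay⟩
  have hu := commutator_pow_shift_apply hsx hsy hmx hmy
  have huL : ∀ N : ℕ, (xQ + (N : KQ)) / xQ ∈ fieldX := fun N =>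
    div_mem (add_mem xQ_mem_fieldX (natCast_mem _ N)) xQ_mem_fieldX
  have hu0 : ∀ N : ℕ, (xQ + (N : KQ)) / xQ ≠ 0 := fun N =>
    div_ne_zero (xQ_add_natCast_ne_zero N) xQ_ne_zero
  have huT : ∀ N : ℕ, ⁅s ^ N, m⁆ ∈ scalingGroup := fun N =>
    ⟨(hu N).1, _, huL N, hu0 N, (hu N).2⟩
  have hu1 : ∀ N k : ℕ, N ≠ 0 → k ≠ 0 → ((xQ + (N : KQ)) / xQ) ^ k ≠ 1 := by
    intro N k hN hk h
    rw [div_pow, div_eq_one_iff_eq (pow_ne_zero _ xQ_ne_zero)] at h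
    exact xQ_add_natCast_pow_ne hN hk h
  have hinv : ∀ N : ℕ, N ≠ 0 → ((xQ + (N : KQ)) / xQ)⁻¹ - 1 ≠ 0 := fun N hN =>
    sub_ne_zero.mpr fun h => hu1 N 1 hN one_ne_zero (by rw [pow_one, ← inv_inj, h, inv_one])
  set P : Subgroup CremonaQ := Subgroup.closure {s, a, m}
  refine ⟨?_, ?_, ?_⟩
  · have h0 : (derivedSeries P 0).map P.subtype ≤ affineTranslationGroup := by
      rw [derivedSeries_zero, ← MonoidHom.range_eq_map, Subgroup.range_subtype]
      exact hle
    have h3 : (derivedSeries P 3).map P.subtype ≤ ⊥ := by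
      refine map_derivedSeries_succ_le (map_derivedSeries_succ_le (map_derivedSeries_succ_le h0
        commutator_affineTranslationGroup_le) commutator_affineGroup_le) ?_
      rw [Subgroup.commutator_le]
      intro g hg h hh
      rw [Subgroup.mem_bot, commutatorElement_eq_one_iff_mul_comm]
      exact translationGroup_comm hg hh
    rwa [le_bot_iff, Subgroup.map_eq_bot_iff_of_injective _ P.subtype_injective] at h3
  · intro h
    let s' : P := ⟨s, hs⟩
    let a' : P := ⟨a, ha⟩
    let m' : P := ⟨m, hm⟩
    have hD : ∀ g h : P, ⁅g, h⁆ ∈ derivedSeries P 1 := fun g h =>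
      Subgroup.commutator_mem_commutator (Subgroup.mem_top g) (Subgroup.mem_top h)
    have h2 : ⁅⁅s' ^ 1, m'⁆, ⁅m', a'⁆⁆ ∈ derivedSeries P 2 :=
      Subgroup.commutator_mem_commutator (hD _ _) (hD _ _)
    rw [h, Subgroup.mem_bot] at h2
    have h3 : ⁅⁅s ^ 1, m⁆, ⁅m, a⁆⁆ = 1 := congrArg P.subtype h2
    obtain ⟨hqx, hqy⟩ := commutator_scaling_translation_apply hmx xQ_mem_fieldX xQ_ne_zero hmy hax
      (one_mem _) hay
    have h4 := (commutator_scaling_translation_apply (hu 1).1 (huL 1) (hu0 1) (hu 1).2 hqx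
      (mul_mem (sub_mem (inv_mem xQ_mem_fieldX) (one_mem _)) (one_mem _)) hqy).2
    rw [h3, AlgEquiv.one_apply, left_eq_add, mul_one] at h4
    refine mul_ne_zero (hinv 1 one_ne_zero) (sub_ne_zero.mpr fun h => xQ_ne_one ?_) h4
    rw [← inv_inj, h, inv_one]
  · intro K _ n _ φ
    have hP : ∀ {Q : Subgroup CremonaQ}, (∀ {g h : CremonaQ}, g ∈ Q → h ∈ Q → g * h = h * g) →
        ∀ g ∈ Q.subgroupOf P, ∀ h ∈ Q.subgroupOf P, g * h = h * g :=
      fun hQ g hg h hh => Subtype.ext (hQ hg hh)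
    refine not_injective_of_commutator (K := K) (T := scalingGroup.subgroupOf P)
      (V := translationGroup.subgroupOf P) (s := ⟨s, hs⟩) (t := ⟨m, hm⟩) (v := ⟨a, ha⟩)
      (hP scalingGroup_comm) (hP translationGroup_comm) hmT haV
      (fun h hh => conj_mem_scalingGroup hsx hsy hh)
      (fun N h hh => conj_mem_translationGroup (huT N) hh) ?_ ?_ φ
    · intro N k hN hk h
      have h1 : ⁅s ^ N, m⁆ ^ k = 1 := congrArg P.subtype h
      have key : ∀ k : ℕ, (⁅s ^ N, m⁆ ^ k) yQ = ((xQ + (N : KQ)) / xQ) ^ k * yQ := by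
        intro k
        induction k with
        | zero => simp
        | succ k ih =>
          rw [pow_succ', AlgEquiv.mul_apply, ih, map_mul, (hu N).2, map_pow,
            map_eq_self_of_mem_fieldX (hu N).1 (huL N), pow_succ, mul_assoc]
      have h2 := key k
      rw [h1, AlgEquiv.one_apply] at h2
      exact hu1 N k hN hk (mul_right_cancel₀ yQ_ne_zero (h2.symm.trans (one_mul _).symm))
    · intro N k hN h
      have key : ∀ k : ℕ, ((fun w => ⁅⁅s ^ N, m⁆, w⁆)^[k] a) xQ = xQ ∧
          ((fun w => ⁅⁅s ^ N, m⁆, w⁆)^[k] a) yQ =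
            yQ + (((xQ + (N : KQ)) / xQ)⁻¹ - 1) ^ k := by
        intro k
        induction k with
        | zero => simp [hax, hay]
        | succ k ih =>
          rw [Function.iterate_succ_apply', pow_succ']
          exact commutator_scaling_translation_apply (hu N).1 (huL N) (hu0 N) (hu N).2 ih.1
            (pow_mem (sub_mem (inv_mem (huL N)) (one_mem _)) k) ih.2
      have hsemi : Function.Semiconj P.subtype
          (fun w => ⁅⁅(⟨s, hs⟩ : P) ^ N, (⟨m, hm⟩ : P)⁆, w⁆) (fun w => ⁅⁅s ^ N, m⁆, w⁆) := fun _ => rfl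
      have h1 : (fun w => ⁅⁅s ^ N, m⁆, w⁆)^[k] a = 1 :=
        ((hsemi.iterate_right k) ⟨a, ha⟩).symm.trans (congrArg P.subtype h)
      have h2 := (key k).2
      rw [h1, AlgEquiv.one_apply, left_eq_add] at h2
      exact pow_ne_zero k (hinv N hN) h2
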